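/- Let 𝒜 be a supersolvable line arrangement in ℙ²(ℝ) with m := m(𝒜) ≥ 3, |𝒜| = 2m, and |Sing₂(𝒜)| = m. Then |Sing(𝒜)| = C(m+1,2) + 1 = m(m+1)/2 + 1, and the subarrangement 𝒜_h consisting of the m lines of 𝒜 not passing through a modular point of maximum multiplicity is generic, i.e. every singular point of 𝒜_h is simple, so |Sing(𝒜_h)| = C(m,2). -/

import Mathlib

open scoped Classical

/-- A point of the projective plane over `K`. -/
abbrev Pt (K : Type*) [Field K] := Projectivization K (Fin 3 → K)

/-- A (candidate) line arrangement: a finite set of linear subspaces of `K³`. -/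
abbrev Arr (K : Type*) [Field K] := Finset (Submodule K (Fin 3 → K))

/-- Every member of `A` is a projective line, i.e. a 2-dimensional linear subspace of `K³`. -/
def IsLineArr {K : Type*} [Field K] (A : Arr K) : Prop :=
  ∀ L ∈ A, Module.finrank K L = 2

/-- The multiplicity `m(P, A)`: the number of lines of `A` passing through `P`. -/
noncomputable def multAt {K : Type*} [Field K] (A : Arr K) (P : Pt K) : ℕ :=
  (A.filter fun L => P.submodule ≤ L).card

/-- `Sing(A)`: the set of points lying on at least two lines of `A`. -/
def SingSet {K : Type*} [Field K] (A : Arr K) : Set (Pt K) :=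
  {P | 2 ≤ multAt A P}

/-- `Sing₂(A)`: the set of simple points, i.e. singular points of multiplicity exactly 2. -/
def Sing2Set {K : Type*} [Field K] (A : Arr K) : Set (Pt K) :=
  {P | multAt A P = 2}

/-- `m(A)`: the maximum multiplicity of a singular point of `A`. -/
noncomputable def maxMult {K : Type*} [Field K] (A : Arr K) : ℕ :=
  sSup (multAt A '' SingSet A)

/-- `P` is a modular point of `A`: it is singular, and for every other singular point `Q`
the line through `P` and `Q` belongs to `A`. -/
def IsModular {K : Type*} [Field K] (A : Arr K) (P : Pt K) : Prop :=
  P ∈ SingSet A ∧ ∀ Q ∈ SingSet A, Q ≠ P → (P.submodule ⊔ Q.submodule) ∈ A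

/-- `A` is supersolvable: it has a modular point. -/
def Supersolvable {K : Type*} [Field K] (A : Arr K) : Prop :=
  ∃ P, IsModular A P

/-- `A` has full rank (rank 3): its lines have no common point. -/
def FullRank {K : Type*} [Field K] (A : Arr K) : Prop :=
  (⨅ L ∈ A, L) = ⊥

section Incidence

variable {K : Type*} [Field K]

lemma Pt.finrank_submodule (P : Pt K) : Module.finrank K P.submodule = 1 := by
  rw [Projectivization.submodule_eq]
  exact finrank_span_singleton P.rep_nonzero

lemma Pt.eq_of_submodule_le {P Q : Pt K} (h : P.submodule ≤ Q.submodule) : P = Q :=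
  Projectivization.submodule_injective <|
    Submodule.eq_of_le_of_finrank_eq h (by rw [P.finrank_submodule, Q.finrank_submodule])

lemma Pt.sup_eq_of_le {P Q : Pt K} (hPQ : P ≠ Q) {L : Submodule K (Fin 3 → K)}
    (hL : Module.finrank K L = 2) (hP : P.submodule ≤ L) (hQ : Q.submodule ≤ L) :
    P.submodule ⊔ Q.submodule = L := by
  refine Submodule.eq_of_le_of_finrank_le (sup_le hP hQ) ?_
  have h := Submodule.finrank_sup_add_finrank_inf_eq P.submodule Q.submodule
  have hlt : P.submodule ⊓ Q.submodule < P.submodule :=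
    inf_lt_left.2 fun h => hPQ (Pt.eq_of_submodule_le h)
  have := Submodule.finrank_lt_finrank_of_lt hlt
  have := P.finrank_submodule
  have := Q.finrank_submodule
  omega

lemma Pt.exists_le_inf {L M : Submodule K (Fin 3 → K)} (hL : Module.finrank K L = 2)
    (hM : Module.finrank K M = 2) : ∃ P : Pt K, P.submodule ≤ L ∧ P.submodule ≤ M := by
  have h := Submodule.finrank_sup_add_finrank_inf_eq L M
  have h3 := Submodule.finrank_le (L ⊔ M)
  rw [Module.finrank_fin_fun] at h3
  have hne : L ⊓ M ≠ ⊥ := fun h0 => by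
    rw [h0, finrank_bot] at h
    omega
  obtain ⟨v, hv, hv0⟩ := Submodule.exists_mem_ne_zero_of_ne_bot hne
  refine ⟨Projectivization.mk K v hv0, ?_⟩
  rw [← le_inf_iff, Projectivization.submodule_mk, Submodule.span_singleton_le_iff_mem]
  exact hv

/-- A common point of two lines, for distinct lines the unique one. -/
noncomputable def meet (L M : Submodule K (Fin 3 → K)) : Pt K :=
  Classical.epsilon fun P : Pt K => P.submodule ≤ L ∧ P.submodule ≤ M

variable {A : Arr K}

lemma IsLineArr.meet_le (hA : IsLineArr A) {L M : Submodule K (Fin 3 → K)} (hL : L ∈ A)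
    (hM : M ∈ A) : (meet L M).submodule ≤ L ∧ (meet L M).submodule ≤ M :=
  Classical.epsilon_spec (Pt.exists_le_inf (hA L hL) (hA M hM))

lemma IsLineArr.eq_of_le (hA : IsLineArr A) {P Q : Pt K} (hPQ : P ≠ Q)
    {L M : Submodule K (Fin 3 → K)} (hL : L ∈ A) (hM : M ∈ A) (hPL : P.submodule ≤ L)
    (hQL : Q.submodule ≤ L) (hPM : P.submodule ≤ M) (hQM : Q.submodule ≤ M) : L = M :=
  (Pt.sup_eq_of_le hPQ (hA L hL) hPL hQL).symm.trans (Pt.sup_eq_of_le hPQ (hA M hM) hPM hQM)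

lemma IsLineArr.meet_eq_iff (hA : IsLineArr A) {L M : Submodule K (Fin 3 → K)} (hL : L ∈ A)
    (hM : M ∈ A) (hLM : L ≠ M) {P : Pt K} :
    meet L M = P ↔ P.submodule ≤ L ∧ P.submodule ≤ M := by
  have h := hA.meet_le hL hM
  constructor
  · rintro rfl
    exact h
  · intro hP
    by_contra hne
    exact hLM (hA.eq_of_le hne hL hM h.1 hP.1 h.2 hP.2)

lemma mem_singSet_iff {P : Pt K} : P ∈ SingSet A ↔
    ∃ L ∈ A, ∃ M ∈ A, P.submodule ≤ L ∧ P.submodule ≤ M ∧ L ≠ M := by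
  change 1 < (A.filter fun L => P.submodule ≤ L).card ↔ _
  rw [Finset.one_lt_card]
  simp only [Finset.mem_filter]
  grind

lemma IsLineArr.finite_singSet (hA : IsLineArr A) : (SingSet A).Finite := by
  refine ((A ×ˢ A).image fun p => meet p.1 p.2).finite_toSet.subset fun P hP => ?_
  obtain ⟨L, hL, M, hM, hPL, hPM, hne⟩ := mem_singSet_iff.1 hP
  simp only [Finset.coe_image, Set.mem_image, Finset.mem_coe, Finset.mem_product]
  exact ⟨(L, M), ⟨hL, hM⟩, (hA.meet_eq_iff hL hM hne).2 ⟨hPL, hPM⟩⟩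

lemma bddAbove_multAt (A : Arr K) : BddAbove (multAt A '' SingSet A) := by
  refine ⟨A.card, ?_⟩
  rintro _ ⟨P, -, rfl⟩
  exact Finset.card_filter_le _ _

lemma multAt_le_maxMult {P : Pt K} (hP : P ∈ SingSet A) : multAt A P ≤ maxMult A :=
  le_csSup (bddAbove_multAt A) ⟨P, hP, rfl⟩

lemma exists_multAt_eq_maxMult (hA : maxMult A ≠ 0) :
    ∃ P ∈ SingSet A, multAt A P = maxMult A := by
  refine Nat.sSup_mem ?_ (bddAbove_multAt A)
  by_contra h
  rw [Set.not_nonempty_iff_eq_empty] at h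
  exact hA (by rw [maxMult, h, csSup_empty]; rfl)

lemma IsModular.multAt_lt (hA : IsLineArr A) {P Q : Pt K} (hP : IsModular A P)
    (hQ : Q ∈ SingSet A) (hQm : ¬ IsModular A Q) : multAt A Q < multAt A P := by
  obtain ⟨R, hR, hRQ, hQR⟩ : ∃ R ∈ SingSet A, R ≠ Q ∧ Q.submodule ⊔ R.submodule ∉ A := by
    by_contra! h
    exact hQm ⟨hQ, h⟩
  have hPQ : P ≠ Q := fun h => hQm (h ▸ hP)
  have hRP : R ≠ P := by
    rintro rfl
    exact hQR (sup_comm R.submodule Q.submodule ▸ hP.2 Q hQ hPQ.symm)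
  have hno : ∀ L ∈ A, R.submodule ≤ L → ¬ Q.submodule ≤ L := fun L hL hRL hQL =>
    hQR (Pt.sup_eq_of_le hRQ.symm (hA L hL) hQL hRL ▸ hL)
  obtain ⟨L, hL, hRL, hPL⟩ : ∃ L ∈ A, R.submodule ≤ L ∧ ¬ P.submodule ≤ L := by
    obtain ⟨L, hL, M, hM, hRL, hRM, hne⟩ := mem_singSet_iff.1 hR
    by_contra! h
    exact hne (hA.eq_of_le hRP hL hM hRL (h L hL hRL) hRM (h M hM hRM))
  have hQL := hno L hL hRL
  have key : ∀ M ∈ A, Q.submodule ≤ M → meet M L ∈ SingSet A ∧ meet M L ≠ P ∧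
      (meet M L).submodule ≤ M ∧ (meet M L).submodule ≤ L := by
    intro M hM hQM
    have hml := hA.meet_le hM hL
    refine ⟨mem_singSet_iff.2 ⟨M, hM, L, hL, hml.1, hml.2, ?_⟩, ?_, hml⟩
    · rintro rfl
      exact hQL hQM
    · intro h
      exact hPL (h ▸ hml.2)
  have hinj : ∀ S T : Pt K, S ≠ P → S.submodule ≤ L → T.submodule ≤ L →
      P.submodule ⊔ S.submodule ∈ A → P.submodule ⊔ S.submodule = P.submodule ⊔ T.submodule →
      S = T := by
    intro S T hSP hS hT hmem heq
    by_contra hne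
    have h1 : T.submodule ≤ P.submodule ⊔ S.submodule := heq ▸ le_sup_right
    exact hPL (hA.eq_of_le hne hmem hL le_sup_right h1 hS hT ▸ le_sup_left)
  have hsub : ((A.filter fun M => Q.submodule ≤ M).image
      fun M => P.submodule ⊔ (meet M L).submodule) ⊆
      (A.filter fun M => P.submodule ≤ M).erase (P.submodule ⊔ R.submodule) := by
    intro N hN
    obtain ⟨M, hM, rfl⟩ := Finset.mem_image.1 hN
    obtain ⟨hM, hQM⟩ := Finset.mem_filter.1 hM
    obtain ⟨h1, h2, h3, h4⟩ := key M hM hQM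
    have hmem := hP.2 _ h1 h2
    refine Finset.mem_erase.2 ⟨fun h => ?_, Finset.mem_filter.2 ⟨hmem, le_sup_left⟩⟩
    have := hinj _ _ h2 h4 hRL hmem h
    exact hno M hM (this ▸ h3) hQM
  have hcard := Finset.card_le_card hsub
  rw [Finset.card_image_of_injOn, Finset.card_erase_of_mem] at hcard
  · have : 2 ≤ multAt A P := hP.1
    unfold multAt at *
    omega
  · exact Finset.mem_filter.2 ⟨hP.2 R hR hRP, le_sup_left⟩
  · intro M hM N hN h
    obtain ⟨hM, hQM⟩ := Finset.mem_filter.1 hM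
    obtain ⟨hN, hQN⟩ := Finset.mem_filter.1 hN
    obtain ⟨h1, h2, h3, h4⟩ := key M hM hQM
    obtain ⟨-, -, h5, h6⟩ := key N hN hQN
    have heq := hinj _ _ h2 h4 h6 (hP.2 _ h1 h2) h
    rw [← heq] at h5
    have hne : Q ≠ meet M L := fun h => hQL (h ▸ h4)
    exact hA.eq_of_le hne hM hN hQM h3 hQN h5

lemma Supersolvable.isModular_of_multAt_eq (hA : IsLineArr A) (hss : Supersolvable A) {Q : Pt K}
    (hQ : Q ∈ SingSet A) (hQm : multAt A Q = maxMult A) : IsModular A Q := by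
  obtain ⟨P, hP⟩ := hss
  by_contra h
  have := hP.multAt_lt hA hQ h
  have := multAt_le_maxMult hP.1
  omega

lemma multAt_add_card_off (A : Arr K) (Q : Pt K) :
    multAt A Q + (A.filter fun L => ¬ Q.submodule ≤ L).card = A.card :=
  Finset.card_filter_add_card_filter_not _

lemma mem_singSet_of_mem_off {P Q : Pt K}
    (hP : P ∈ SingSet (A.filter fun L => ¬ Q.submodule ≤ L)) :
    P ∈ SingSet A ∧ P ≠ Q := by
  obtain ⟨L, hL, M, hM, hPL, hPM, hne⟩ := mem_singSet_iff.1 hP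
  rw [Finset.mem_filter] at hL hM
  exact ⟨mem_singSet_iff.2 ⟨L, hL.1, M, hM.1, hPL, hPM, hne⟩, fun h => hL.2 (h ▸ hPL)⟩

namespace IsModular

variable {Q : Pt K}

lemma multAt_eq (hA : IsLineArr A) (hQ : IsModular A Q) {P : Pt K} (hP : P ∈ SingSet A)
    (hPQ : P ≠ Q) : multAt A P = multAt (A.filter fun L => ¬ Q.submodule ≤ L) P + 1 := by
  have h := Finset.card_filter_add_card_filter_not (s := A.filter fun L => P.submodule ≤ L)
    (fun L => Q.submodule ≤ L)
  have h1 : ((A.filter fun L => P.submodule ≤ L).filter fun L => Q.submodule ≤ L) =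
      {Q.submodule ⊔ P.submodule} := by
    ext L
    simp only [Finset.mem_filter, Finset.mem_singleton]
    constructor
    · rintro ⟨⟨hL, hPL⟩, hQL⟩
      exact (Pt.sup_eq_of_le hPQ.symm (hA L hL) hQL hPL).symm
    · rintro rfl
      exact ⟨⟨hQ.2 P hP hPQ, le_sup_right⟩, le_sup_left⟩
  rw [h1, Finset.card_singleton, Finset.filter_comm] at h
  unfold multAt
  omega

lemma sum_multAt_off (hA : IsLineArr A) (hQ : IsModular A Q) {S : Finset (Pt K)}
    (hS : ∀ P, P ∈ S ↔ P ∈ SingSet A ∧ P ≠ Q) :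
    ∑ P ∈ S, multAt (A.filter fun L => ¬ Q.submodule ≤ L) P =
      multAt A Q * (A.filter fun L => ¬ Q.submodule ≤ L).card := by
  have hne : ∀ L M, Q.submodule ≤ L → ¬ Q.submodule ≤ M → L ≠ M := by
    rintro L _ hL hM rfl
    exact hM hL
  have hmaps : Set.MapsTo (fun p : Submodule K (Fin 3 → K) × Submodule K (Fin 3 → K) =>
      meet p.1 p.2)
      ((A.filter fun L => Q.submodule ≤ L) ×ˢ (A.filter fun L => ¬ Q.submodule ≤ L) :) S := by
    rintro ⟨L, M⟩ hp
    simp only [Finset.mem_coe, Finset.mem_product, Finset.mem_filter] at hp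
    obtain ⟨⟨hL, hQL⟩, hM, hQM⟩ := hp
    have hml := hA.meet_le hL hM
    refine (hS _).2 ⟨mem_singSet_iff.2 ⟨L, hL, M, hM, hml.1, hml.2, hne L M hQL hQM⟩, fun h => ?_⟩
    exact hQM (h ▸ hml.2)
  rw [multAt, ← Finset.card_product, Finset.card_eq_sum_card_fiberwise hmaps]
  refine Finset.sum_congr rfl fun P hP => ?_
  obtain ⟨hP, hPQ⟩ := (hS P).1 hP
  rw [multAt, ← one_mul (Finset.card _), ← Finset.card_singleton (Q.submodule ⊔ P.submodule),
    ← Finset.card_product]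
  congr 1
  ext ⟨L, M⟩
  simp only [Finset.mem_product, Finset.mem_singleton, Finset.mem_filter]
  constructor
  · rintro ⟨rfl, ⟨hM, hQM⟩, hPM⟩
    have hL := hQ.2 P hP hPQ
    exact ⟨⟨⟨hL, le_sup_left⟩, hM, hQM⟩,
      (hA.meet_eq_iff hL hM (hne _ _ le_sup_left hQM)).2 ⟨le_sup_right, hPM⟩⟩
  · rintro ⟨⟨⟨hL, hQL⟩, hM, hQM⟩, hml⟩
    rw [hA.meet_eq_iff hL hM (hne _ _ hQL hQM)] at hml
    exact ⟨(Pt.sup_eq_of_le hPQ.symm (hA L hL) hQL hml.1).symm, ⟨hM, hQM⟩, hml.2⟩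

end IsModular

lemma IsLineArr.sum_multAt_mul_self_sub (hA : IsLineArr A) {S : Finset (Pt K)}
    (hS : SingSet A ⊆ S) :
    ∑ P ∈ S, (multAt A P * multAt A P - multAt A P) = A.card * A.card - A.card := by
  have hmaps : Set.MapsTo (fun p : Submodule K (Fin 3 → K) × Submodule K (Fin 3 → K) =>
      meet p.1 p.2) A.offDiag S := by
    rintro ⟨L, M⟩ hp
    simp only [Finset.mem_coe, Finset.mem_offDiag] at hp
    obtain ⟨hL, hM, hne⟩ := hp
    have hml := hA.meet_le hL hM
    exact hS (mem_singSet_iff.2 ⟨L, hL, M, hM, hml.1, hml.2, hne⟩)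
  rw [← Finset.offDiag_card, Finset.card_eq_sum_card_fiberwise hmaps]
  refine Finset.sum_congr rfl fun P hP => ?_
  rw [multAt, ← Finset.offDiag_card]
  congr 1
  ext ⟨L, M⟩
  simp only [Finset.mem_offDiag, Finset.mem_filter]
  constructor
  · rintro ⟨⟨hL, hPL⟩, ⟨hM, hPM⟩, hne⟩
    exact ⟨⟨hL, hM, hne⟩, (hA.meet_eq_iff hL hM hne).2 ⟨hPL, hPM⟩⟩
  · rintro ⟨⟨hL, hM, hne⟩, hml⟩
    rw [hA.meet_eq_iff hL hM hne] at hml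
    exact ⟨⟨hL, hml.1⟩, ⟨hM, hml.2⟩, hne⟩

end Incidence

/-- A positive integer valued function on a finite set whose value `1` is attained `m` times,
with sum `m * m` and with `m * m - m` as the sum of `a * a - a`, is bounded by `2`. -/
lemma le_two_of_sum_eq {ι : Type*} {S : Finset ι} {a : ι → ℕ} {m : ℕ}
    (h0 : ∀ i ∈ S, 1 ≤ a i) (h1 : (S.filter fun i => a i = 1).card = m)
    (hs : ∑ i ∈ S, a i = m * m) (hq : ∑ i ∈ S, (a i * a i - a i) = m * m - m) :
    ∀ i ∈ S, a i ≤ 2 := by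
  have hle : ∀ i ∈ S, a i ≤ (a i * a i - a i) + if a i = 1 then 1 else 0 := by
    intro i hi
    have := h0 i hi
    split_ifs with h
    · omega
    · have : 2 * a i ≤ a i * a i := Nat.mul_le_mul_right _ (by omega)
      omega
  have hsum : ∑ i ∈ S, a i = ∑ i ∈ S, ((a i * a i - a i) + if a i = 1 then 1 else 0) := by
    rw [Finset.sum_add_distrib, ← Finset.card_filter, h1, hq, hs]
    have := Nat.le_mul_self m
    omega
  intro i hi
  have heq := (Finset.sum_eq_sum_iff_of_le hle).1 hsum i hi
  by_contra! h
  rw [if_neg (by omega)] at heq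
  have : 3 * a i ≤ a i * a i := Nat.mul_le_mul_right _ h
  omega

/-- For a function with values in `{1, 2}`, the sum and the number of ones determine the size of
the domain. -/
lemma two_mul_card_eq_of_le_two {ι : Type*} {S : Finset ι} {a : ι → ℕ}
    (h0 : ∀ i ∈ S, 1 ≤ a i) (h2 : ∀ i ∈ S, a i ≤ 2) :
    2 * S.card = ∑ i ∈ S, a i + (S.filter fun i => a i = 1).card := by
  rw [Finset.card_filter, ← Finset.sum_add_distrib, mul_comm, ← smul_eq_mul,
    ← Finset.sum_const]
  refine Finset.sum_congr rfl fun i hi => ?_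
  have := h0 i hi
  have := h2 i hi
  split_ifs <;> omega

/-- Double counting at a point `Q` of maximum multiplicity. -/
lemma IsModular.sing_count {K : Type*} [Field K] {A : Arr K} (hA : IsLineArr A) {Q : Pt K}
    (hQ : IsModular A Q) (hm : 3 ≤ multAt A Q) (hcard : A.card = 2 * multAt A Q)
    (hs2 : (Sing2Set A).ncard = multAt A Q) :
    (SingSet A).ncard = Nat.choose (multAt A Q + 1) 2 + 1 ∧
      (A.filter fun L => ¬ Q.submodule ≤ L).card = multAt A Q ∧
      (∀ P ∈ SingSet (A.filter fun L => ¬ Q.submodule ≤ L),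
        multAt (A.filter fun L => ¬ Q.submodule ≤ L) P = 2) ∧
      (SingSet (A.filter fun L => ¬ Q.submodule ≤ L)).ncard = Nat.choose (multAt A Q) 2 := by
  have hoff := multAt_add_card_off A Q
  generalize hB : (A.filter fun L => ¬ Q.submodule ≤ L) = B at *
  have hBA : IsLineArr B := fun L hL => hA L (Finset.mem_filter.1 (hB ▸ hL)).1
  have hBcard : B.card = multAt A Q := by omega
  let S := hA.finite_singSet.toFinset.erase Q
  have hS : ∀ P, P ∈ S ↔ P ∈ SingSet A ∧ P ≠ Q := fun P => by simp [S, and_comm]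
  have hBS : ∀ P ∈ SingSet B, P ∈ S := fun P hP =>
    (hS P).2 (mem_singSet_of_mem_off (hB ▸ hP))
  have hmult : ∀ P ∈ S, multAt A P = multAt B P + 1 := fun P hP =>
    hB ▸ hQ.multAt_eq hA ((hS P).1 hP).1 ((hS P).1 hP).2
  have h0 : ∀ P ∈ S, 1 ≤ multAt B P := fun P hP => by
    have h : 2 ≤ multAt A P := ((hS P).1 hP).1
    have := hmult P hP
    omega
  have hcS : (SingSet A).ncard = S.card + 1 := by
    rw [Set.ncard_eq_toFinset_card _ hA.finite_singSet]
    exact (Finset.card_erase_add_one (hA.finite_singSet.mem_toFinset.2 hQ.1)).symm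
  have h1 : (S.filter fun P => multAt B P = 1).card = multAt A Q := by
    rw [← hs2, ← Set.ncard_coe_finset]
    congr 1
    ext P
    simp only [Finset.coe_filter, Set.mem_ofPred_eq, Sing2Set]
    constructor
    · rintro ⟨hP, h⟩
      rw [hmult P hP, h]
    · intro h
      have hP : P ∈ S := (hS P).2 ⟨h.ge, fun hPQ => by rw [hPQ] at h; omega⟩
      have := hmult P hP
      exact ⟨hP, by omega⟩
  have hs : ∑ P ∈ S, multAt B P = multAt A Q * multAt A Q := by
    have := hQ.sum_multAt_off hA hS
    rwa [hB, hBcard] at this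
  have hq := hBA.sum_multAt_mul_self_sub hBS
  rw [hBcard] at hq
  have h2 := le_two_of_sum_eq h0 h1 hs hq
  have hSc := two_mul_card_eq_of_le_two h0 h2
  rw [h1, hs] at hSc
  have hgen : ∀ P ∈ SingSet B, multAt B P = 2 := fun P hP =>
    le_antisymm (h2 P (hBS P hP)) hP
  have hcB : (SingSet B).ncard + multAt A Q = S.card := by
    rw [← Finset.card_filter_add_card_filter_not (s := S) (fun P => multAt B P = 1), h1, add_comm,
      ← Set.ncard_coe_finset]
    congr 2
    ext P
    simp only [Finset.coe_filter, Set.mem_ofPred_eq]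
    constructor
    · intro hP
      exact ⟨hBS P hP, by rw [hgen P hP]; decide⟩
    · rintro ⟨hP, h⟩
      have := h0 P hP
      change 2 ≤ multAt B P
      omega
  have hch : S.card = Nat.choose (multAt A Q + 1) 2 := by
    rw [Nat.choose_two_right, Nat.add_sub_cancel, add_mul, one_mul, ← hSc]
    omega
  refine ⟨by rw [hcS, hch], hBcard, hgen, ?_⟩
  have : (multAt A Q + 1).choose 2 = (multAt A Q).choose 1 + (multAt A Q).choose 2 :=
    Nat.choose_succ_succ' (multAt A Q) 1
  rw [Nat.choose_one_right] at this
  omega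

/-- If `A` is a real supersolvable arrangement with `m := m(A) ≥ 3`,
`|A| = 2m` and `|Sing₂(A)| = m`, then `|Sing(A)| = C(m+1,2) + 1`, and for any modular point
`Q` of maximum multiplicity, the subarrangement `A_h` of the `m` lines of `A` not passing
through `Q` is generic, so `|Sing(A_h)| = C(m,2)`. -/
theorem extremal_sing_count (A : Arr ℝ) (hA : IsLineArr A) (hss : Supersolvable A)
    (hm : 3 ≤ maxMult A) (hcard : A.card = 2 * maxMult A)
    (hs2 : (Sing2Set A).ncard = maxMult A) :
    (SingSet A).ncard = Nat.choose (maxMult A + 1) 2 + 1 ∧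
    ∀ Q ∈ SingSet A, multAt A Q = maxMult A →
      (A.filter fun L => ¬ Q.submodule ≤ L).card = maxMult A ∧
      (∀ P ∈ SingSet (A.filter fun L => ¬ Q.submodule ≤ L),
        multAt (A.filter fun L => ¬ Q.submodule ≤ L) P = 2) ∧
      (SingSet (A.filter fun L => ¬ Q.submodule ≤ L)).ncard = Nat.choose (maxMult A) 2 := by
  have key : ∀ Q ∈ SingSet A, multAt A Q = maxMult A → _ := fun Q hQ hQm =>
    (hss.isModular_of_multAt_eq hA hQ hQm).sing_count hA (hQm ▸ hm) (hQm ▸ hcard) (hQm ▸ hs2)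
  obtain ⟨Q, hQ, hQm⟩ := exists_multAt_eq_maxMult (A := A) (by omega)
  refine ⟨hQm ▸ (key Q hQ hQm).1, fun Q hQ hQm => ?_⟩
  rw [← hQm]
  exact (key Q hQ hQm).2
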